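/- Let A be the 4×4 reciprocal matrix with rows (1, a_12, a_13, 1), (1/a_12, 1, a_23, 1), (1/a_13, 1/a_23, 1, 1), (1, 1, 1, 1), where a_12, a_13, a_23 > 0 satisfy one of: (i) a_13 ≥ 1 and a_12, a_23 > 1; (ii) a_12 ≥ a_13 ≥ a_23 = 1; (iii) a_23 ≥ a_13 ≥ a_12 = 1; (iv) a_13 > 1 and a_12, a_23 < 1. Then C(A) ⊆ E(A) if and only if a_13 ≤ a_12·a_23. -/

import Mathlib

open Matrix

/-- An `n × n` real matrix is *reciprocal* if all its entries are positive and
`A j i = 1 / A i j` for all `i, j`. -/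
def IsReciprocal {n : ℕ} (A : Matrix (Fin n) (Fin n) ℝ) : Prop :=
  (∀ i j, 0 < A i j) ∧ ∀ i j, A j i = 1 / A i j

/-- A positive vector `w` is *efficient* for `A` if every positive vector `v` whose
associated consistent matrix approximates `A` at least as well entrywise is
proportional to `w`. -/
def IsEfficient {n : ℕ} (A : Matrix (Fin n) (Fin n) ℝ) (w : Fin n → ℝ) : Prop :=
  (∀ i, 0 < w i) ∧
    ∀ v : Fin n → ℝ, (∀ i, 0 < v i) →
      (∀ i j, |A i j - v i / v j| ≤ |A i j - w i / w j|) → ∃ c : ℝ, v = c • w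

/-- The set of efficient vectors for `A`. -/
def EffSet {n : ℕ} (A : Matrix (Fin n) (Fin n) ℝ) : Set (Fin n → ℝ) :=
  {w | IsEfficient A w}

/-- The cone generated by the columns of `A`: nonzero vectors of the form `A · u`
with `u` entrywise nonnegative. -/
def ConeCols {n : ℕ} (A : Matrix (Fin n) (Fin n) ℝ) : Set (Fin n → ℝ) :=
  {w | w ≠ 0 ∧ ∃ u : Fin n → ℝ, (∀ i, 0 ≤ u i) ∧ w = A.mulVec u}

/-- A *monomial* matrix: the product of a permutation matrix and a diagonal matrix
with positive diagonal entries. -/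
def IsMonomial {n : ℕ} (S : Matrix (Fin n) (Fin n) ℝ) : Prop :=
  ∃ (σ : Equiv.Perm (Fin n)) (d : Fin n → ℝ), (∀ i, 0 < d i) ∧
    S = σ.permMatrix ℝ * Matrix.diagonal d

/-- An edge `i → j` forces `v i / w i ≤ v j / w j`. -/
lemma edge_le {a vi vj wi wj : ℝ} (hvj : 0 < vj) (hwi : 0 < wi) (hwj : 0 < wj)
    (he : a * wj ≤ wi) (h : |a - vi / vj| ≤ |a - wi / wj|) : vi / wi ≤ vj / wj := by
  have h1 : a ≤ wi / wj := by rwa [le_div_iff₀ hwj]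
  rw [abs_of_nonpos (by linarith : a - wi / wj ≤ 0)] at h
  have h2 := neg_abs_le (a - vi / vj)
  have h3 : vi / vj ≤ wi / wj := by linarith
  rw [div_le_div_iff₀ hvj hwj] at h3
  rw [div_le_div_iff₀ hwi hwj]
  linarith

/-- If the vertex `k` is a strict sink, the vector is not efficient. -/
lemma not_eff_of_sink {n : ℕ} {A : Matrix (Fin n) (Fin n) ℝ} (hA : IsReciprocal A)
    {w : Fin n → ℝ} (k l : Fin n) (hl : l ≠ k) (m : ℝ) (hm : w k < m)
    (h : ∀ j, j ≠ k → A j k * m ≤ w j) : ¬ IsEfficient A w := by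
  rintro ⟨hw, hE⟩
  have hm0 : 0 < m := (hw k).trans hm
  obtain ⟨c, hc⟩ := hE (Function.update w k m) (by
    intro i
    by_cases hi : i = k
    · subst hi; simpa using hm0
    · simpa [hi] using hw i) (by
    intro i j
    by_cases hi : i = k
    · subst hi
      by_cases hj : j = i
      · subst hj
        simp [hm0.ne', (hw j).ne']
      · simp only [Function.update_self, Function.update_of_ne hj]
        have h1 : m / w j ≤ A i j := by
          have h2 := h j hj
          rw [hA.2 i j, one_div, inv_mul_le_iff₀ (hA.1 i j)] at h2
          rwa [div_le_iff₀ (hw j)]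
        have h3 : w i / w j ≤ m / w j := by
          have := hw j
          gcongr
        rw [abs_of_nonneg (by linarith), abs_of_nonneg (by linarith)]
        linarith
    · by_cases hj : j = k
      · subst hj
        simp only [Function.update_self, Function.update_of_ne hi]
        have h1 : A i j ≤ w i / m := by
          rw [le_div_iff₀ hm0]; exact h i hi
        have h3 : w i / m ≤ w i / w j := by
          have := hw j
          have := hw i
          gcongr
        rw [abs_of_nonpos (by linarith), abs_of_nonpos (by linarith)]
        linarith
      · simp [Function.update_of_ne hi, Function.update_of_ne hj])
  have e1 := congrFun hc l
  have e2 := congrFun hc k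
  simp only [Function.update_self, Function.update_of_ne hl, Pi.smul_apply, smul_eq_mul] at e1 e2
  have : c = 1 := by
    have := hw l
    have h4 : (c - 1) * w l = 0 := by linarith
    rcases mul_eq_zero.1 h4 with h5 | h5 <;> linarith
  subst this
  linarith

lemma recip (a12 a13 a23 : ℝ) (h12 : 0 < a12) (h13 : 0 < a13) (h23 : 0 < a23) :
    IsReciprocal !![1, a12, a13, 1; 1 / a12, 1, a23, 1; 1 / a13, 1 / a23, 1, 1; 1, 1, 1, 1] := by
  constructor
  · intro i j
    fin_cases i <;> fin_cases j <;> simp <;> assumption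
  · intro i j
    fin_cases i <;> fin_cases j <;> simp

lemma mulVec_eq (a b c : ℝ) (u : Fin 4 → ℝ) :
    !![1, a, c, 1; 1 / a, 1, b, 1; 1 / c, 1 / b, 1, 1; 1, 1, 1, 1].mulVec u =
    ![u 0 + a * u 1 + c * u 2 + u 3, u 0 / a + u 1 + b * u 2 + u 3,
      u 0 / c + u 1 / b + u 2 + u 3, u 0 + u 1 + u 2 + u 3] := by
  funext i
  fin_cases i <;> simp [Matrix.mulVec, dotProduct, Fin.sum_univ_four] <;> ring

/-- A four-cycle `0 → 3 → 2 → 1 → 0` gives efficiency. -/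
lemma eff_of_cycle {A : Matrix (Fin 4) (Fin 4) ℝ} {w : Fin 4 → ℝ} (hw : ∀ i, 0 < w i)
    (h1 : A 0 3 * w 3 ≤ w 0) (h2 : A 3 2 * w 2 ≤ w 3) (h3 : A 2 1 * w 1 ≤ w 2)
    (h4 : A 1 0 * w 0 ≤ w 1) : IsEfficient A w := by
  refine ⟨hw, fun v hv h => ⟨v 0 / w 0, ?_⟩⟩
  have e1 := edge_le (hv _) (hw _) (hw _) h1 (h 0 3)
  have e2 := edge_le (hv _) (hw _) (hw _) h2 (h 3 2)
  have e3 := edge_le (hv _) (hw _) (hw _) h3 (h 2 1)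
  have e4 := edge_le (hv _) (hw _) (hw _) h4 (h 1 0)
  have key : ∀ i, v i / w i = v 0 / w 0 := by
    intro i
    fin_cases i
    · rfl
    · exact le_antisymm e4 (by simpa using by linarith)
    · exact le_antisymm (by simpa using by linarith) (by simpa using by linarith)
    · exact le_antisymm (by simpa using by linarith) (by simpa using by linarith)
  funext i
  rw [Pi.smul_apply, smul_eq_mul, ← key i, div_mul_cancel₀ _ (hw i).ne']

lemma backward (a b c : ℝ) (ha : 1 ≤ a) (hc : 1 ≤ c) (hb : 1 ≤ b) (h : c ≤ a * b) :
    ConeCols !![1, a, c, 1; 1 / a, 1, b, 1; 1 / c, 1 / b, 1, 1; 1, 1, 1, 1] ⊆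
      EffSet !![1, a, c, 1; 1 / a, 1, b, 1; 1 / c, 1 / b, 1, 1; 1, 1, 1, 1] := by
  rintro w ⟨hw0, u, hu, rfl⟩
  have a0 : 0 < a := by linarith
  have b0 : 0 < b := by linarith
  have c0 : 0 < c := by linarith
  have hs : ∃ i, 0 < u i := by
    by_contra! hn
    apply hw0
    have : u = 0 := funext fun i => le_antisymm (hn i) (hu i)
    rw [this, Matrix.mulVec_zero]
  have hpos := (recip a c b a0 c0 b0).1
  refine eff_of_cycle ?_ ?_ ?_ ?_ ?_
  · intro i
    obtain ⟨j, hj⟩ := hs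
    exact Finset.sum_pos' (fun k _ => mul_nonneg (hpos i k).le (hu k))
      ⟨j, Finset.mem_univ _, mul_pos (hpos i j) hj⟩
  all_goals
    rw [mulVec_eq]
    have x0 := hu 0
    have y0 := hu 1
    have z0 := hu 2
    have t0 := hu 3
    simp
    generalize u 0 = x at *
    generalize u 1 = y at *
    generalize u 2 = z at *
    generalize u 3 = t at *
  · nlinarith [mul_nonneg (sub_nonneg.2 ha) y0, mul_nonneg (sub_nonneg.2 hc) z0]
  · have := div_le_self x0 hc
    have := div_le_self y0 hb
    linarith
  · rw [inv_mul_le_iff₀ b0]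
    have e : b * (x / c + y / b + z + t) = b * (x / c) + y + b * z + b * t := by
      field_simp
    have e2 : x / a ≤ b * (x / c) := by
      rw [← mul_div_assoc, div_le_div_iff₀ a0 c0]
      nlinarith [mul_nonneg (sub_nonneg.2 h) x0]
    nlinarith [mul_nonneg (sub_nonneg.2 hb) t0]
  · rw [inv_mul_le_iff₀ a0]
    have e : a * (x / a + y + b * z + t) = x + a * y + a * b * z + a * t := by
      field_simp
    nlinarith [mul_nonneg (sub_nonneg.2 ha) t0, mul_nonneg (sub_nonneg.2 h) z0]

lemma forward1 (a b c : ℝ) (ha : 1 < a) (hc : 1 ≤ c) (hb : 1 < b) (h : a * b < c) :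
    ¬ ConeCols !![1, a, c, 1; 1 / a, 1, b, 1; 1 / c, 1 / b, 1, 1; 1, 1, 1, 1] ⊆
      EffSet !![1, a, c, 1; 1 / a, 1, b, 1; 1 / c, 1 / b, 1, 1; 1, 1, 1, 1] := by
  intro hsub
  have a0 : 0 < a := by linarith
  have b0 : 0 < b := by linarith
  have c0 : 0 < c := by linarith
  have c1 : 1 < c := by nlinarith
  have ha' : 0 < a - 1 := by linarith
  have hb' : 0 < b - 1 := by linarith
  have hd : 0 < c - a * b := by linarith
  have hab := mul_pos ha' hb'
  obtain ⟨q, hq⟩ : ∃ q : ℝ, q = (1 + 2 * c) / 3 := ⟨_, rfl⟩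
  obtain ⟨p, hp⟩ : ∃ p : ℝ, p = (2 + c) / 3 := ⟨_, rfl⟩
  have p1 : 1 < p := by linarith
  have pq : p < q := by linarith
  have qc : q < c := by linarith
  have hx : 0 < (b - 1) * a * q := mul_pos (mul_pos hb' a0) (by linarith)
  have hz : 0 < (a - 1) * p := mul_pos ha' (by linarith)
  have hE := @hsub (Matrix.mulVec _ ![(b - 1) * a * q, 0, (a - 1) * p, c - a * b])
    ⟨?_, _, ?_, rfl⟩
  · change IsEfficient _ _ at hE
    rw [mulVec_eq] at hE
    simp at hE
    obtain ⟨x, hxe⟩ : ∃ x : ℝ, x = (b - 1) * q := ⟨_, rfl⟩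
    have ex : (b - 1) * a * q = a * x := by rw [hxe]; ring
    rw [ex] at hE
    have e1 : a * x / a = x := by field_simp
    rw [e1] at hE
    revert hE
    have R := recip a c b a0 c0 b0
    simp only [one_div] at R
    refine not_eff_of_sink R 1 0 (by decide)
      (min ((a * x + c * ((a - 1) * p) + (c - a * b)) / a)
        (min (b * (a * x / c + (a - 1) * p + (c - a * b)))
          (a * x + (a - 1) * p + (c - a * b)))) ?_ ?_
    · simp only [lt_min_iff]
      refine ⟨?_, ?_, ?_⟩
      · simp
        rw [lt_div_iff₀ a0]
        nlinarith [mul_pos (mul_pos ha' hd) (sub_pos.2 p1)]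
      · simp
        have : x < b * (a * x / c) + (b - 1) * (c - a * b) := by
          have e : b * (a * x / c) = x - x * (c - a * b) / c := by field_simp; ring
          have : x * (c - a * b) / c < (b - 1) * (c - a * b) := by
            rw [div_lt_iff₀ c0, hxe]
            nlinarith [mul_pos (mul_pos hb' hd) (sub_pos.2 qc)]
          linarith
        nlinarith
      · simp
        nlinarith [mul_pos hab (sub_pos.2 pq)]
    · intro j hj
      fin_cases j
      · simp
        rw [← le_div_iff₀' a0]
        exact min_le_left _ _
      · simp at hj
      · simp
        rw [inv_mul_le_iff₀ b0]
        exact (min_le_right _ _).trans (min_le_left _ _)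
      · simp
  · intro h0
    have := congrFun h0 3
    rw [mulVec_eq] at this
    simp at this
    linarith
  · intro i
    fin_cases i <;> simp <;> linarith

lemma forward2 (a b c : ℝ) (a0 : 0 < a) (b0 : 0 < b) (ha : a < 1) (hc : 1 < c) (hb : b < 1) :
    ¬ ConeCols !![1, a, c, 1; 1 / a, 1, b, 1; 1 / c, 1 / b, 1, 1; 1, 1, 1, 1] ⊆
      EffSet !![1, a, c, 1; 1 / a, 1, b, 1; 1 / c, 1 / b, 1, 1; 1, 1, 1, 1] := by
  intro hsub
  have c0 : 0 < c := by linarith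
  have ha' : 0 < 1 - a := by linarith
  have hb' : 0 < 1 - b := by linarith
  have hc' : 0 < c - 1 := by linarith
  have hd : a * b < c := by nlinarith
  obtain ⟨r, s, r0, r1, s1, hrs⟩ : ∃ r s : ℝ, 0 < r ∧ r < 1 ∧ 1 < s ∧ a * b * s < c * r := by
    have k0 : 0 < a * b / c := by positivity
    have k1 : a * b / c < 1 := by rwa [div_lt_one c0]
    have ek : a * b = (a * b / c) * c := by field_simp
    generalize a * b / c = k at *
    refine ⟨1 - (1 - k) / 3, 1 + (1 - k) / 3, by linarith, by linarith, by linarith, ?_⟩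
    rw [ek]
    have : k * (1 + (1 - k) / 3) < 1 - (1 - k) / 3 := by nlinarith
    nlinarith
  have hx : 0 < (1 - b) * s := mul_pos hb' (by linarith)
  have hax : 0 < a * ((1 - b) * s) := mul_pos a0 hx
  have hy : 0 < (c - 1) * r := mul_pos hc' r0
  have hE := @hsub (Matrix.mulVec _ ![a * ((1 - b) * s), (c - 1) * r, 1 - a, 0])
    ⟨?_, _, ?_, rfl⟩
  · change IsEfficient _ _ at hE
    rw [mulVec_eq] at hE
    simp at hE
    have e1 : a * ((1 - b) * s) / a = (1 - b) * s := by field_simp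
    rw [e1] at hE
    revert hE
    have R := recip a c b a0 c0 b0
    simp only [one_div] at R
    refine not_eff_of_sink R 3 0 (by decide)
      (min (a * ((1 - b) * s) + a * ((c - 1) * r) + c * (1 - a))
        (min ((1 - b) * s + (c - 1) * r + b * (1 - a))
          (a * ((1 - b) * s) / c + (c - 1) * r / b + (1 - a)))) ?_ ?_
    · simp only [lt_min_iff]
      refine ⟨?_, ?_, ?_⟩
      · simp
        nlinarith [mul_pos (mul_pos ha' hc') (sub_pos.2 r1)]
      · simp
        nlinarith [mul_pos (mul_pos ha' hb') (sub_pos.2 s1)]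
      · simp
        rw [div_add_div _ _ c0.ne' b0.ne', lt_div_iff₀ (by positivity)]
        nlinarith [mul_pos (mul_pos hc' hb') (sub_pos.2 hrs)]
    · intro j hj
      fin_cases j
      · simp
      · simp
      · simp
      · simp at hj
  · intro h0
    have := congrFun h0 3
    rw [mulVec_eq] at this
    simp at this
    linarith
  · intro i
    fin_cases i <;> simp <;> linarith

/-- Theorem tmain4by4: characterization. -/
theorem coneCols_subset_effSet_iff (a12 a13 a23 : ℝ)
    (h12 : 0 < a12) (h13 : 0 < a13) (h23 : 0 < a23)
    (hcond : ((1 ≤ a13 ∧ 1 < a12 ∧ 1 < a23) ∨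
      (a13 ≤ a12 ∧ a23 ≤ a13 ∧ a23 = 1) ∨
      (a13 ≤ a23 ∧ a12 ≤ a13 ∧ a12 = 1) ∨
      (1 < a13 ∧ a12 < 1 ∧ a23 < 1))) :
    (ConeCols !![1, a12, a13, 1; 1 / a12, 1, a23, 1; 1 / a13, 1 / a23, 1, 1; 1, 1, 1, 1] ⊆
      EffSet !![1, a12, a13, 1; 1 / a12, 1, a23, 1; 1 / a13, 1 / a23, 1, 1; 1, 1, 1, 1]) ↔
      a13 ≤ a12 * a23 := by
  constructor
  · intro hsub
    by_contra! hlt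
    rcases hcond with ⟨h1, h2, h3⟩ | ⟨h1, h2, h3⟩ | ⟨h1, h2, h3⟩ | ⟨h1, h2, h3⟩
    · exact forward1 a12 a23 a13 h2 h1 h3 hlt hsub
    · subst h3; linarith
    · subst h3; linarith
    · exact forward2 a12 a23 a13 h12 h23 h2 h1 h3 hsub
  · intro hle
    rcases hcond with ⟨h1, h2, h3⟩ | ⟨h1, h2, h3⟩ | ⟨h1, h2, h3⟩ | ⟨h1, h2, h3⟩
    · exact backward a12 a23 a13 h2.le h1 h3.le hle
    · exact backward a12 a23 a13 (by linarith) (by linarith) (by linarith) hle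
    · exact backward a12 a23 a13 (by linarith) (by linarith) (by linarith) hle
    · nlinarith
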